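/- For every natural number n, the identity C(3n,n)·2/(n+1) = C(3n+1,n)·1/(3n+1) + C(3n+2,n)·2/(3n+2) holds, where C(a,b) denotes the binomial coefficient. -/

import Mathlib

theorem stmt_0 (n : ℕ) :
    (Nat.choose (3 * n) n : ℚ) * 2 / (n + 1)
      = (Nat.choose (3 * n + 1) n : ℚ) * 1 / (3 * n + 1)
        + (Nat.choose (3 * n + 2) n : ℚ) * 2 / (3 * n + 2) := by
  have h1 := Nat.choose_mul_succ_eq (3 * n) n
  have h2 := Nat.choose_mul_succ_eq (3 * n + 1) n
  rw [show 3 * n + 1 - n = 2 * n + 1 by omega] at h1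
  rw [show 3 * n + 1 + 1 - n = 2 * n + 2 by omega, show 3 * n + 1 + 1 = 3 * n + 2 by omega] at h2
  have h1' : (Nat.choose (3 * n) n : ℚ) * (3 * n + 1)
      = (Nat.choose (3 * n + 1) n : ℚ) * (2 * n + 1) := by exact_mod_cast h1
  have h2' : (Nat.choose (3 * n + 1) n : ℚ) * (3 * n + 2)
      = (Nat.choose (3 * n + 2) n : ℚ) * (2 * n + 2) := by exact_mod_cast h2
  have p1 : (n : ℚ) + 1 ≠ 0 := by positivity
  have p2 : (3 * n : ℚ) + 1 ≠ 0 := by positivity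
  have p3 : (3 * n : ℚ) + 2 ≠ 0 := by positivity
  have e1 : (Nat.choose (3 * n) n : ℚ)
      = (Nat.choose (3 * n + 1) n : ℚ) * (2 * n + 1) / (3 * n + 1) := by
    rw [eq_div_iff p2]; exact h1'
  have e2 : (Nat.choose (3 * n + 2) n : ℚ)
      = (Nat.choose (3 * n + 1) n : ℚ) * (3 * n + 2) / (2 * (n + 1)) := by
    rw [eq_div_iff (by positivity)]; linarith
  rw [e1, e2]
  field_simp
  ring
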